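/- arXiv:1404.7599 — 7 statements merged into one kernel-verified Lean document; each statement's English description precedes it below -/
import Mathlib

section
/- Let (𝒳, 𝒵, 𝒴) be a hereditary cotorsion triple in 𝒜. Then an object of 𝒜 belongs to both 𝒵 and 𝒴 if and only if it is an injective object, i.e., 𝒵 ∩ 𝒴 = ℐ, the class of injective objects of 𝒜. -/
open CategoryTheory Abelian Limits ZeroObject

universe v u

variable {A : Type u} [Category.{v} A] [Abelian A]
  [EnoughProjectives A] [EnoughInjectives A]

noncomputable instance : HasExt.{max u v} A :=
  have := HasDerivedCategory.standard A
  hasExt_of_hasDerivedCategory A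

/-- Vanishing of the `n`-th Ext group. -/
def extZero (M N : A) (n : ℕ) : Prop := Subsingleton (Abelian.Ext M N n)

/-- `(X, Z)` is a cotorsion pair: `X` consists exactly of the objects `M` with
`Ext¹(M, Z') = 0` for all `Z' ∈ Z`, and `Z` consists exactly of the objects `M`
with `Ext¹(X', M) = 0` for all `X' ∈ X`. -/
def IsCotorsionPair (X Z : Set A) : Prop :=
  (∀ M : A, M ∈ X ↔ ∀ Z' ∈ Z, extZero M Z' 1) ∧
  (∀ M : A, M ∈ Z ↔ ∀ X' ∈ X, extZero X' M 1)

/-- A cotorsion pair is hereditary if `Ext^i(X', Z') = 0` for all `X' ∈ X`,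
`Z' ∈ Z` and all `i ≥ 1`. -/
def IsHereditaryCotorsionPair (X Z : Set A) : Prop :=
  IsCotorsionPair X Z ∧ ∀ X' ∈ X, ∀ Z' ∈ Z, ∀ i : ℕ, 1 ≤ i → extZero X' Z' i

/-- A cotorsion pair is complete if every object `M` admits short exact sequences
`0 → Z' → X' → M → 0` and `0 → M → Z'' → X'' → 0` with `X', X'' ∈ X` and `Z', Z'' ∈ Z`. -/
def IsCompleteCotorsionPair (X Z : Set A) : Prop :=
  IsCotorsionPair X Z ∧
    ∀ M : A,
      (∃ (Z' X' : A) (f : Z' ⟶ X') (g : X' ⟶ M) (w : f ≫ g = 0),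
        (ShortComplex.mk f g w).ShortExact ∧ X' ∈ X ∧ Z' ∈ Z) ∧
      (∃ (Z'' X'' : A) (f : M ⟶ Z'') (g : Z'' ⟶ X'') (w : f ≫ g = 0),
        (ShortComplex.mk f g w).ShortExact ∧ X'' ∈ X ∧ Z'' ∈ Z)

/-- `(X, Z, Y)` is a cotorsion triple if `(X, Z)` and `(Z, Y)` are cotorsion pairs. -/
def IsCotorsionTriple (X Z Y : Set A) : Prop :=
  IsCotorsionPair X Z ∧ IsCotorsionPair Z Y

/-- A cotorsion triple is hereditary if both constituent cotorsion pairs are hereditary. -/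
def IsHereditaryCotorsionTriple (X Z Y : Set A) : Prop :=
  IsHereditaryCotorsionPair X Z ∧ IsHereditaryCotorsionPair Z Y

/-- A cotorsion triple is complete and hereditary if both constituent cotorsion pairs
are complete and hereditary. -/
def IsCompleteHereditaryCotorsionTriple (X Z Y : Set A) : Prop :=
  IsCompleteCotorsionPair X Z ∧ IsCompleteCotorsionPair Z Y ∧
    IsHereditaryCotorsionPair X Z ∧ IsHereditaryCotorsionPair Z Y

/-- Let `(𝒳, 𝒵, 𝒴)` be a hereditary cotorsion triple in `𝒜`. Then
`𝒵 ∩ 𝒴 = ℐ`, the class of injective objects of `𝒜`. -/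
theorem inter_eq_injectives (X Z Y : Set A) (h : IsHereditaryCotorsionTriple X Z Y) :
    Z ∩ Y = {M : A | Injective M} := by
  obtain ⟨⟨hXZ, hXZ'⟩, ⟨hZY, -⟩⟩ := h
  ext M
  simp only [Set.mem_inter_iff, Set.mem_setOf_eq]
  have hinjZ : ∀ I : A, Injective I → I ∈ Z := fun I hI =>
    (hXZ.2 I).2 fun X' _ => Ext.subsingleton_of_injective X' I 0
  constructor
  · rintro ⟨hZ, hY⟩
    have hS : (ShortComplex.mk _ _ (cokernel.condition (Injective.ι M))).ShortExact :=
      { exact := ShortComplex.exact_cokernel _ }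
    have hC : cokernel (Injective.ι M) ∈ Z := by
      refine (hXZ.2 _).2 fun X' hX' => ⟨fun a b => ?_⟩
      suffices H : ∀ x : Ext X' (cokernel (Injective.ι M)) 1, x = 0 by rw [H a, H b]
      intro x
      have h2 : Subsingleton (Ext X' M 2) := hXZ' X' hX' M hZ 2 (by norm_num)
      obtain ⟨y, hy⟩ := Ext.covariant_sequence_exact₃ X' hS x (n₁ := 2) (by norm_num)
        (Subsingleton.elim (α := Ext X' M 2) _ _)
      rw [← hy, Ext.eq_zero_of_injective y, Ext.zero_comp]
    have h1 : Subsingleton (Ext (cokernel (Injective.ι M)) M 1) := (hZY.1 _).1 hC M hY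
    obtain ⟨y, hy⟩ := Ext.contravariant_sequence_exact₁ hS M (Ext.mk₀ (𝟙 M)) (n₁ := 1)
      (by norm_num) (Subsingleton.elim (α := Ext (cokernel (Injective.ι M)) M 1) _ _)
    obtain ⟨r, rfl⟩ := (Ext.mk₀_bijective _ _).2 y
    rw [Ext.mk₀_comp_mk₀] at hy
    have hr := (Ext.mk₀_bijective _ _).1 hy
    exact Retract.injective (Y := Injective.under M) { i := Injective.ι M, r := r, retract := hr }
  · intro hM
    exact ⟨hinjZ M hM, (hZY.2 M).2 fun Z' _ => Ext.subsingleton_of_injective Z' M 0⟩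
end

section
/- Let (𝒳, 𝒵, 𝒴) be a hereditary cotorsion triple in 𝒜, let M ∈ 𝒳, and let 0 → N → Y → L → 0 be a short exact sequence in 𝒜 with Y ∈ 𝒴 and L ∈ 𝒵 (that is, the monomorphism f : N → Y is a special left 𝒴-approximation of N). Then every morphism α : M → L lifts along the cokernel map g : Y → L; i.e., there exists β : M → Y with g ∘ β = α. -/
open CategoryTheory Abelian Limits ZeroObject

universe v u

variable {A : Type u} [Category.{v} A] [Abelian A]
  [EnoughProjectives A] [EnoughInjectives A]

/-- Let `(𝒳, 𝒵, 𝒴)` be a hereditary cotorsion triple, `M ∈ 𝒳`, and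
`0 → N → Y → L → 0` a short exact sequence with `Y ∈ 𝒴` and `L ∈ 𝒵`
(i.e. `f : N ⟶ Y` is a special left `𝒴`-approximation of `N`). Then every
morphism `α : M ⟶ L` lifts along `g : Y ⟶ L`. -/
theorem lifts_of_mem_left (X Z Y : Set A) (h : IsHereditaryCotorsionTriple X Z Y)
    (M : A) (hM : M ∈ X) {N Y₀ L : A} (f : N ⟶ Y₀) (g : Y₀ ⟶ L) (w : f ≫ g = 0)
    (hse : (ShortComplex.mk f g w).ShortExact) (hY : Y₀ ∈ Y) (hL : L ∈ Z)
    (α : M ⟶ L) : ∃ β : M ⟶ Y₀, β ≫ g = α := by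
  obtain ⟨⟨⟨_, hXZ⟩, hXZ'⟩, ⟨⟨hZ, _⟩, hZY⟩⟩ := h
  let p : Projective.over L ⟶ L := Projective.π L
  let S : ShortComplex A := ShortComplex.mk (kernel.ι p) p (kernel.condition p)
  have hS : S.ShortExact :=
    { exact := ShortComplex.exact_kernel p
      mono_f := inferInstanceAs (Mono (kernel.ι p))
      epi_g := inferInstanceAs (Epi (Projective.π L)) }
  have hK : kernel p ∈ Z := by
    rw [hZ]
    intro Y' hY'
    have h2 : Subsingleton (Abelian.Ext L Y' 2) := hZY L hL Y' hY' 2 (by norm_num)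
    refine subsingleton_of_forall_eq 0 fun x => ?_
    obtain ⟨x₂, rfl⟩ := Ext.contravariant_sequence_exact₁ hS Y' (n₀ := 1) (n₁ := 2) x rfl
      (h2.elim _ _)
    have : x₂ = 0 := by
      have : Projective S.X₂ := inferInstanceAs (Projective (Projective.over L))
      exact Ext.eq_zero_of_projective x₂
    rw [this, Ext.comp_zero]
  have h1 : Subsingleton (Abelian.Ext M (kernel p) 1) := hXZ' M hM _ hK 1 le_rfl
  obtain ⟨y, hy⟩ := Ext.covariant_sequence_exact₃ M hS (n₀ := 0) (n₁ := 1)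
    (Ext.mk₀ α) rfl (h1.elim _ _)
  obtain ⟨γ, rfl⟩ := (Ext.mk₀_bijective _ _).2 y
  rw [Ext.mk₀_comp_mk₀] at hy
  have hγ : γ ≫ p = α := (Ext.mk₀_bijective _ _).1 hy
  have : Epi g := hse.epi_g
  refine ⟨γ ≫ Projective.factorThru p g, ?_⟩
  rw [Category.assoc, Projective.factorThru_comp, hγ]
end

section
/- Let (𝒳, 𝒵, 𝒴) be a complete hereditary cotorsion triple in 𝒜 and let M be an object of 𝒜. Then M ∈ 𝒳 if and only if for every object N, every monomorphism f : N → Y that is a left 𝒴-approximation of N (Y ∈ 𝒴 and composition with f maps Hom(Y, Y') onto Hom(N, Y') for every Y' ∈ 𝒴), and every morphism α : M → Coker(f), there exists β : M → Y with g ∘ β = α, where g : Y → Coker(f) is the cokernel projection. -/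
open CategoryTheory Abelian Limits ZeroObject

universe v u

variable {A : Type u} [Category.{v} A] [Abelian A]
  [EnoughProjectives A] [EnoughInjectives A]

/-- Extension of morphisms when `Ext¹` vanishes. -/
lemma aux_extend {S : ShortComplex A} (hS : S.ShortExact) {W : A}
    (hW : extZero S.X₃ W 1) (u : S.X₁ ⟶ W) : ∃ k : S.X₂ ⟶ W, S.f ≫ k = u := by
  have : Subsingleton (Ext S.X₃ W 1) := hW
  obtain ⟨x, hx⟩ := Ext.contravariant_sequence_exact₁ hS W (Ext.mk₀ u) (n₁ := 1) rfl
    (Subsingleton.elim _ _)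
  obtain ⟨k, rfl⟩ := (Ext.mk₀_bijective _ _).2 x
  rw [Ext.mk₀_comp_mk₀] at hx
  exact ⟨k, (Ext.mk₀_bijective _ _).1 hx⟩

/-- Lifting of morphisms when `Ext¹` vanishes. -/
lemma aux_lift {S : ShortComplex A} (hS : S.ShortExact) {W : A}
    (hW : extZero W S.X₁ 1) (u : W ⟶ S.X₃) : ∃ k : W ⟶ S.X₂, k ≫ S.g = u := by
  have : Subsingleton (Ext W S.X₁ 1) := hW
  obtain ⟨x, hx⟩ := Ext.covariant_sequence_exact₃ W hS (Ext.mk₀ u) (n₁ := 1) rfl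
    (Subsingleton.elim _ _)
  obtain ⟨k, rfl⟩ := (Ext.mk₀_bijective _ _).2 x
  rw [Ext.mk₀_comp_mk₀] at hx
  exact ⟨k, (Ext.mk₀_bijective _ _).1 hx⟩

/-- The left class of a hereditary cotorsion pair is closed under kernels of epimorphisms. -/
lemma aux_left_closed {X Z : Set A} (h : IsHereditaryCotorsionPair X Z)
    {S : ShortComplex A} (hS : S.ShortExact) (h2 : S.X₂ ∈ X) (h3 : S.X₃ ∈ X) : S.X₁ ∈ X := by
  refine (h.1.1 _).2 fun W hW => ?_
  have i2 : Subsingleton (Ext S.X₂ W 1) := h.2 _ h2 _ hW 1 le_rfl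
  have i3 : Subsingleton (Ext S.X₃ W 2) := h.2 _ h3 _ hW 2 (by norm_num)
  refine subsingleton_of_forall_eq 0 fun e => ?_
  obtain ⟨x, hx⟩ := Ext.contravariant_sequence_exact₁ hS W e (n₁ := 2) rfl
    (Subsingleton.elim _ _)
  rw [← hx, Subsingleton.elim x 0, Ext.comp_zero]

/-- The right class of a hereditary cotorsion pair is closed under cokernels of monomorphisms. -/
lemma aux_right_closed {X Z : Set A} (h : IsHereditaryCotorsionPair X Z)
    {S : ShortComplex A} (hS : S.ShortExact) (h1 : S.X₁ ∈ Z) (h2 : S.X₂ ∈ Z) : S.X₃ ∈ Z := by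
  refine (h.1.2 _).2 fun W hW => ?_
  have i2 : Subsingleton (Ext W S.X₂ 1) := h.2 _ hW _ h2 1 le_rfl
  have i3 : Subsingleton (Ext W S.X₁ 2) := h.2 _ hW _ h1 2 (by norm_num)
  refine subsingleton_of_forall_eq 0 fun e => ?_
  obtain ⟨x, hx⟩ := Ext.covariant_sequence_exact₃ W hS e (n₁ := 2) rfl
    (Subsingleton.elim _ _)
  rw [← hx, Subsingleton.elim x 0, Ext.zero_comp]

/-- Injective objects lie in the right class of any cotorsion pair. -/
lemma aux_injective_mem {X Z : Set A} (h : IsCotorsionPair X Z) (I : A) [Injective I] :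
    I ∈ Z :=
  (h.2 _).2 fun _ _ => subsingleton_of_forall_eq 0 Ext.eq_zero_of_injective

lemma aux_coker_shortExact {N W : A} (f : N ⟶ W) [Mono f] :
    (ShortComplex.mk f (cokernel.π f) (cokernel.condition f)).ShortExact :=
  { exact := ShortComplex.exact_cokernel f
    mono_f := by assumption
    epi_g := by dsimp; infer_instance }

lemma aux_ker_shortExact {N W : A} (f : N ⟶ W) [Epi f] :
    (ShortComplex.mk (kernel.ι f) f (kernel.condition f)).ShortExact :=
  { exact := ShortComplex.exact_kernel f
    mono_f := by dsimp; infer_instance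
    epi_g := by assumption }

/-- Let `(𝒳, 𝒵, 𝒴)` be a complete hereditary cotorsion triple and `M` an object.
Then `M ∈ 𝒳` if and only if, for every monic left `𝒴`-approximation `f : N ⟶ Y`,
every morphism `α : M ⟶ Coker f` lifts along the cokernel projection. -/
theorem mem_left_iff_lifts (X Z Y : Set A)
    (h : IsCompleteHereditaryCotorsionTriple X Z Y) (M : A) :
    M ∈ X ↔
      ∀ (N Y₀ : A) (f : N ⟶ Y₀), Mono f → Y₀ ∈ Y →
        (∀ Y' ∈ Y, ∀ u : N ⟶ Y', ∃ k : Y₀ ⟶ Y', f ≫ k = u) →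
        ∀ α : M ⟶ cokernel f, ∃ β : M ⟶ Y₀, β ≫ cokernel.π f = α := by
  obtain ⟨-, hZY, hXZh, hZYh⟩ := h
  constructor
  · intro hM N Y₀ f hf hY₀ happ α
    obtain ⟨Y₁, Z₁, f₁, g₁, w₁, hS₁, hZ₁, hY₁⟩ := (hZY.2 N).2
    -- lift through the special approximation
    have key : ∀ a : M ⟶ Z₁, ∃ b : M ⟶ Y₁, b ≫ g₁ = a := by
      intro a
      obtain ⟨Y₂, Z₂, f₂, g₂, w₂, hS₂, hZ₂, hY₂⟩ := (hZY.2 Y₁).1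
      have e₁ : Epi g₁ := hS₁.epi_g
      have e₂ : Epi g₂ := hS₂.epi_g
      have hK := aux_ker_shortExact (g₂ ≫ g₁)
      have hKZ : kernel (g₂ ≫ g₁) ∈ Z := aux_left_closed hZYh hK hZ₂ hZ₁
      obtain ⟨b, hb⟩ := aux_lift hK (W := M) (hXZh.2 _ hM _ hKZ 1 le_rfl) a
      exact ⟨b ≫ g₂, by simpa using hb⟩
    obtain ⟨k, hk⟩ := happ _ hY₁ f₁
    obtain ⟨l, hl⟩ := aux_extend hS₁ (W := Y₀) (hZYh.2 _ hZ₁ _ hY₀ 1 le_rfl) f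
    dsimp at hl
    -- induced maps on cokernels
    let c : cokernel f ⟶ Z₁ := cokernel.desc f (k ≫ g₁) (by rw [← Category.assoc, hk, w₁])
    have hc : cokernel.π f ≫ c = k ≫ g₁ := cokernel.π_desc _ _ _
    have e₁ : Epi g₁ := hS₁.epi_g
    have hz : f₁ ≫ l ≫ cokernel.π f = 0 := by
      rw [← Category.assoc, hl, cokernel.condition]
    let d : Z₁ ⟶ cokernel f := hS₁.exact.desc (l ≫ cokernel.π f) hz
    have hd : g₁ ≫ d = l ≫ cokernel.π f := hS₁.exact.g_desc _ _
    let s : cokernel f ⟶ Y₀ := cokernel.desc f (𝟙 Y₀ - k ≫ l) (by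
      rw [Preadditive.comp_sub, Category.comp_id, ← Category.assoc, hk, hl, sub_self])
    have hs : cokernel.π f ≫ s = 𝟙 Y₀ - k ≫ l := cokernel.π_desc _ _ _
    have hid : c ≫ d + s ≫ cokernel.π f = 𝟙 _ := by
      rw [← cancel_epi (cokernel.π f), Preadditive.comp_add, ← Category.assoc, hc,
        Category.assoc, hd, ← Category.assoc (cokernel.π f) s, hs, Preadditive.sub_comp]
      simp
    obtain ⟨b, hb⟩ := key (α ≫ c)
    refine ⟨b ≫ l + α ≫ s, ?_⟩
    rw [Preadditive.add_comp, Category.assoc, ← hd, ← Category.assoc, hb, Category.assoc,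
      Category.assoc, ← Preadditive.comp_add, hid, Category.comp_id]
  · intro hlift
    refine (hXZh.1.1 _).2 fun Z₀ hZ₀ => ?_
    let f : Z₀ ⟶ Injective.under Z₀ := Injective.ι Z₀
    have hS := aux_coker_shortExact f
    have hJ : cokernel f ∈ Z := aux_right_closed hXZh hS hZ₀ (aux_injective_mem hXZh.1 _)
    have hl := hlift _ _ f inferInstance (aux_injective_mem hZYh.1 _) fun Y' hY' u =>
      aux_extend hS (W := Y') (hZYh.2 _ hJ _ hY' 1 le_rfl) u
    refine subsingleton_of_forall_eq 0 fun e => ?_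
    obtain ⟨x, hx⟩ := Ext.covariant_sequence_exact₁ M hS e
      (Ext.eq_zero_of_injective _) (n₀ := 0) rfl
    obtain ⟨a, rfl⟩ := (Ext.mk₀_bijective _ _).2 x
    obtain ⟨b, rfl⟩ := hl a
    rw [← hx, ← Ext.mk₀_comp_mk₀, Ext.comp_assoc_of_second_deg_zero, hS.comp_extClass,
      Ext.comp_zero]
end

section
/- Let (𝒳, 𝒵, 𝒴) be a hereditary cotorsion triple in 𝒜, let M ∈ 𝒴, and let 0 → K → X → N → 0 be a short exact sequence in 𝒜 with X ∈ 𝒳 and K ∈ 𝒵 (that is, the epimorphism f : X → N is a special right 𝒳-approximation of N). Then every morphism α : K → M extends along the kernel inclusion g : K → X; i.e., there exists β : X → M with β ∘ g = α. -/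
open CategoryTheory Abelian Limits ZeroObject

universe v u

variable {A : Type u} [Category.{v} A] [Abelian A]
  [EnoughProjectives A] [EnoughInjectives A]

/-- Let `(𝒳, 𝒵, 𝒴)` be a hereditary cotorsion triple, `M ∈ 𝒴`, and
`0 → K → X → N → 0` a short exact sequence with `X ∈ 𝒳` and `K ∈ 𝒵`
(i.e. `f : X ⟶ N` is a special right `𝒳`-approximation of `N`). Then every
morphism `α : K ⟶ M` extends along `g : K ⟶ X`. -/
theorem extends_of_mem_right (X Z Y : Set A) (h : IsHereditaryCotorsionTriple X Z Y)
    (M : A) (hM : M ∈ Y) {K X₀ N : A} (g : K ⟶ X₀) (f : X₀ ⟶ N) (w : g ≫ f = 0)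
    (hse : (ShortComplex.mk g f w).ShortExact) (hX : X₀ ∈ X) (hK : K ∈ Z)
    (α : K ⟶ M) : ∃ β : X₀ ⟶ M, g ≫ β = α := by
  obtain ⟨⟨hXZ1, hXZ⟩, _, hZY⟩ := h
  let S : ShortComplex A := ShortComplex.mk (Injective.ι K) (cokernel.π (Injective.ι K))
    (cokernel.condition _)
  have hS : S.ShortExact :=
    { exact := ShortComplex.exact_cokernel _
      mono_f := inferInstanceAs (Mono (Injective.ι K))
      epi_g := inferInstanceAs (Epi (cokernel.π (Injective.ι K))) }
  have hC : S.X₃ ∈ Z := by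
    rw [hXZ1.2]
    intro X' hX'
    refine subsingleton_of_forall_eq 0 fun x => ?_
    have h2 : Subsingleton (Abelian.Ext X' S.X₁ 2) := hXZ X' hX' K hK 2 (by norm_num)
    obtain ⟨y, hy⟩ := Ext.covariant_sequence_exact₃ X' hS x (n₁ := 2) rfl
      (Subsingleton.elim _ _)
    have : Injective S.X₂ := inferInstanceAs (Injective (Injective.under K))
    rw [← hy, Ext.eq_zero_of_injective y, Ext.zero_comp]
  have h1 : Subsingleton (Abelian.Ext S.X₃ M 1) := hZY _ hC M hM 1 le_rfl
  obtain ⟨y, hy⟩ := Ext.contravariant_sequence_exact₁ hS M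
    (Ext.mk₀ (show S.X₁ ⟶ M from α)) (n₁ := 1) rfl (Subsingleton.elim _ _)
  obtain ⟨a, rfl⟩ := (Ext.mk₀_bijective _ _).2 y
  rw [Ext.mk₀_comp_mk₀] at hy
  have ha : S.f ≫ a = α := (Ext.mk₀_bijective _ _).1 hy
  have : Mono g := hse.mono_f
  refine ⟨Injective.factorThru (Injective.ι K) g ≫ a, ?_⟩
  rw [← Category.assoc, Injective.comp_factorThru]
  exact ha
end

section
/- Let 𝒜 be a bicomplete abelian category with a complete hereditary cotorsion triple (𝒳, 𝒵, 𝒴). Then the following three classes of morphisms form a Quillen model structure on 𝒜 (the projective model structure): cofibrations are the monomorphisms with cokernel in 𝒳; fibrations are all epimorphisms; weak equivalences are the morphisms f that factor as f = p ∘ i with i a monomorphism whose cokernel is projective and p an epimorphism whose kernel lies in 𝒵. In this model structure the cofibrant objects are exactly the objects of 𝒳, every object is fibrant, and an object M is trivial (i.e., 0 → M is a weak equivalence) exactly when M ∈ 𝒵. -/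
open CategoryTheory Abelian Limits ZeroObject

universe v u

variable {A : Type u} [Category.{v} A] [Abelian A]
  [EnoughProjectives A] [EnoughInjectives A]

/-- `f` is a retract of `g` (in the arrow category). -/
def IsRetract {X₁ Y₁ X₂ Y₂ : A} (f : X₁ ⟶ Y₁) (g : X₂ ⟶ Y₂) : Prop :=
  ∃ (i : Arrow.mk f ⟶ Arrow.mk g) (r : Arrow.mk g ⟶ Arrow.mk f),
    i ≫ r = 𝟙 (Arrow.mk f)

/-- The classes `W` (weak equivalences), `Cof` (cofibrations) and `Fib` (fibrations)
form a Quillen model structure: two-out-of-three for `W`, closure of all three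
classes under retracts, the lifting axioms, and the factorization axioms. -/
structure IsModelStructure (W Cof Fib : MorphismProperty A) : Prop where
  weq_comp : ∀ {X Y Z : A} (f : X ⟶ Y) (g : Y ⟶ Z), W f → W g → W (f ≫ g)
  weq_of_comp_left : ∀ {X Y Z : A} (f : X ⟶ Y) (g : Y ⟶ Z), W (f ≫ g) → W g → W f
  weq_of_comp_right : ∀ {X Y Z : A} (f : X ⟶ Y) (g : Y ⟶ Z), W (f ≫ g) → W f → W g
  weq_retract : ∀ {X₁ Y₁ X₂ Y₂ : A} (f : X₁ ⟶ Y₁) (g : X₂ ⟶ Y₂),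
    IsRetract f g → W g → W f
  cof_retract : ∀ {X₁ Y₁ X₂ Y₂ : A} (f : X₁ ⟶ Y₁) (g : X₂ ⟶ Y₂),
    IsRetract f g → Cof g → Cof f
  fib_retract : ∀ {X₁ Y₁ X₂ Y₂ : A} (f : X₁ ⟶ Y₁) (g : X₂ ⟶ Y₂),
    IsRetract f g → Fib g → Fib f
  lift_trivCof_fib : ∀ {X₁ Y₁ X₂ Y₂ : A} (i : X₁ ⟶ Y₁) (p : X₂ ⟶ Y₂),
    Cof i → W i → Fib p → HasLiftingProperty i p
  lift_cof_trivFib : ∀ {X₁ Y₁ X₂ Y₂ : A} (i : X₁ ⟶ Y₁) (p : X₂ ⟶ Y₂),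
    Cof i → Fib p → W p → HasLiftingProperty i p
  factor_trivCof_fib : ∀ {X Y : A} (f : X ⟶ Y),
    ∃ (Z : A) (i : X ⟶ Z) (p : Z ⟶ Y), Cof i ∧ W i ∧ Fib p ∧ i ≫ p = f
  factor_cof_trivFib : ∀ {X Y : A} (f : X ⟶ Y),
    ∃ (Z : A) (i : X ⟶ Z) (p : Z ⟶ Y), Cof i ∧ Fib p ∧ W p ∧ i ≫ p = f

/-- The weak equivalences of the projective model structure: morphisms factoring as
a monomorphism with projective cokernel followed by an epimorphism with kernel in `𝒵`. -/
def projW (Zs : Set A) : MorphismProperty A := fun X Y f =>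
  ∃ (M : A) (i : X ⟶ M) (p : M ⟶ Y),
    i ≫ p = f ∧ Mono i ∧ Projective (cokernel i) ∧ Epi p ∧ kernel p ∈ Zs

/-- The cofibrations of the projective model structure: monomorphisms with cokernel in `𝒳`. -/
def projCof (Xs : Set A) : MorphismProperty A := fun _ _ f =>
  Mono f ∧ cokernel f ∈ Xs

/-- The fibrations of the projective model structure: all epimorphisms. -/
def projFib : MorphismProperty A := fun _ _ f => Epi f

theorem kerSE {M N : A} (p : M ⟶ N) [Epi p] :
    (ShortComplex.mk (kernel.ι p) p (kernel.condition p)).ShortExact :=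
  { exact := ShortComplex.exact_of_f_is_kernel _ (kernelIsKernel p) }

theorem cokerSE {M N : A} (i : M ⟶ N) [Mono i] :
    (ShortComplex.mk i (cokernel.π i) (cokernel.condition i)).ShortExact :=
  { exact := ShortComplex.exact_of_g_is_cokernel _ (cokernelIsCokernel i) }

theorem extZero.eq0 {M N : A} {n : ℕ} (h : extZero M N n) (x : Ext M N n) : x = 0 :=
  h.elim _ _

theorem extZero_of {M N : A} {n : ℕ} (h : ∀ x : Ext M N n, x = 0) : extZero M N n :=
  ⟨fun a b => by rw [h a, h b]⟩

theorem extZero_proj {P N : A} [Projective P] {n : ℕ} (hn : 1 ≤ n) : extZero P N n := by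
  obtain ⟨k, rfl⟩ := Nat.exists_eq_add_of_le' hn
  exact extZero_of fun x => Ext.eq_zero_of_projective x

theorem extZero_inj {M I : A} [Injective I] {n : ℕ} (hn : 1 ≤ n) : extZero M I n := by
  obtain ⟨k, rfl⟩ := Nat.exists_eq_add_of_le' hn
  exact extZero_of fun x => Ext.eq_zero_of_injective x

theorem extZero_iso_left {M M' N : A} (e : M ≅ M') {n : ℕ} (h : extZero M N n) :
    extZero M' N n := extZero_of fun x => by
  have h1 : (Ext.mk₀ e.inv).comp ((Ext.mk₀ e.hom).comp x (zero_add n)) (zero_add n) = x := by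
    simp
  rw [← h1, h.eq0 ((Ext.mk₀ e.hom).comp x (zero_add n))]; simp

theorem extZero_iso_right {M N N' : A} (e : N ≅ N') {n : ℕ} (h : extZero M N n) :
    extZero M N' n := extZero_of fun x => by
  have h1 : (x.comp (Ext.mk₀ e.inv) (add_zero n)).comp (Ext.mk₀ e.hom) (add_zero n) = x := by
    rw [Ext.comp_assoc_of_third_deg_zero]; simp
  rw [← h1, h.eq0 (x.comp (Ext.mk₀ e.inv) (add_zero n))]; simp

/-- Lifting lemma. -/
theorem lift_of_ext {S T : ShortComplex A} (hS : S.ShortExact) (hT : T.ShortExact)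
    (h : extZero S.X₃ T.X₁ 1) : HasLiftingProperty S.f T.g := by
  refine ⟨fun {a b} sq => ?_⟩
  have := hT.mono_f
  -- the obstruction to lifting `b`
  have h1 : (Ext.mk₀ b).comp hT.extClass (zero_add 1) = 0 := by
    have h2 : (Ext.mk₀ S.f).comp ((Ext.mk₀ b).comp hT.extClass (zero_add 1)) (zero_add 1) = 0 := by
      rw [Ext.mk₀_comp_mk₀_assoc, ← sq.w, ← Ext.mk₀_comp_mk₀_assoc, hT.comp_extClass,
        Ext.comp_zero]
    obtain ⟨y, hy⟩ := Ext.contravariant_sequence_exact₂ hS _ _ h2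
    rw [← hy, h.eq0 y, Ext.comp_zero]
  obtain ⟨l', hl'⟩ := Ext.covariant_sequence_exact₃ _ hT _ _ h1
  obtain ⟨l, rfl⟩ := (Ext.mk₀_bijective _ _).2 l'
  rw [Ext.mk₀_comp_mk₀] at hl'
  have hl := (Ext.mk₀_bijective _ _).1 hl'
  have h3 : (a - S.f ≫ l) ≫ T.g = 0 := by
    rw [Preadditive.sub_comp, Category.assoc, hl, sq.w, sub_self]
  let m := hT.exact.lift _ h3
  have hm : m ≫ T.f = a - S.f ≫ l := hT.exact.lift_f _ h3
  obtain ⟨r', hr'⟩ := Ext.contravariant_sequence_exact₁ hS _ (Ext.mk₀ m) (n₁ := 1) rfl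
    (h.eq0 _)
  obtain ⟨r, rfl⟩ := (Ext.mk₀_bijective _ _).2 r'
  rw [Ext.mk₀_comp_mk₀] at hr'
  have hr := (Ext.mk₀_bijective _ _).1 hr'
  refine ⟨⟨⟨l + r ≫ T.f, ?_, ?_⟩⟩⟩
  · rw [Preadditive.comp_add, ← Category.assoc, hr, hm]; abel
  · rw [Preadditive.add_comp, Category.assoc, T.zero, hl]; simp

/-- Epimorphisms with kernel in `Zs`. -/
def epiKer (Zs : Set A) : MorphismProperty A := fun _ _ p => Epi p ∧ kernel p ∈ Zs

/-- Cofibrations in terms of the left lifting property. -/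
theorem projCof_iff {Xs Zs : Set A} (h : IsCotorsionPair Xs Zs) {M N : A} (i : M ⟶ N) :
    projCof Xs i ↔ Mono i ∧ (epiKer Zs).llp i := by
  constructor
  · rintro ⟨hi, hc⟩
    refine ⟨hi, fun {U V} p hp => ?_⟩
    have := hp.1
    exact lift_of_ext (cokerSE i) (kerSE p) ((h.1 _).1 hc _ hp.2)
  · rintro ⟨hi, hl⟩
    refine ⟨hi, (h.1 _).2 fun Z hZ => ?_⟩
    let j := Injective.ι Z
    have hk : kernel (cokernel.π j) ∈ Zs := by
      refine (h.2 _).2 fun X hX => extZero_iso_right ?_ ((h.2 _).1 hZ X hX)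
      exact (cokerSE j).fIsKernel.conePointUniqueUpToIso (limit.isLimit _)
    have hlp : HasLiftingProperty i (cokernel.π j) := hl _ ⟨inferInstance, hk⟩
    refine extZero_of fun x => ?_
    obtain ⟨y, hy⟩ := Ext.covariant_sequence_exact₁ _ (cokerSE j) x
      ((extZero_inj (I := Injective.under Z) (le_refl 1)).eq0 _) (n₀ := 0) rfl
    obtain ⟨g, rfl⟩ := (Ext.mk₀_bijective _ _).2 y
    have sq : CommSq (0 : M ⟶ Injective.under Z) i (cokernel.π j) (cokernel.π i ≫ g) :=
      ⟨by simp⟩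
    have hf : cokernel.desc i sq.lift sq.fac_left ≫ cokernel.π j = g := by
      rw [← cancel_epi (cokernel.π i)]
      simp
    rw [← hy]
    dsimp at hf ⊢
    rw [← hf, ← Ext.mk₀_comp_mk₀]
    rw [Ext.comp_assoc_of_second_deg_zero]
    have := (cokerSE j).comp_extClass
    dsimp at this
    rw [this, Ext.comp_zero]

/-- Weak equivalences in terms of Ext. -/
def extW (Ys : Set A) : MorphismProperty A := fun M N f =>
  ∀ Y ∈ Ys, ∀ n : ℕ, 1 ≤ n →
    Function.Bijective (fun x : Ext N Y n => (Ext.mk₀ f).comp x (zero_add n))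

theorem ext_inj_of {M N Y : A} {n : ℕ} {f : M ⟶ N}
    (h : ∀ x : Ext N Y n, (Ext.mk₀ f).comp x (zero_add n) = 0 → x = 0) :
    Function.Injective (fun x : Ext N Y n => (Ext.mk₀ f).comp x (zero_add n)) := by
  intro a b hab
  refine sub_eq_zero.1 (h _ ?_)
  dsimp only at hab
  rw [sub_eq_add_neg, Ext.comp_add, Ext.comp_neg, hab, add_neg_cancel]

theorem extW_comp_fun {M N K Y : A} (f : M ⟶ N) (g : N ⟶ K) (n : ℕ) :
    (fun x : Ext K Y n => (Ext.mk₀ (f ≫ g)).comp x (zero_add n)) =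
    (fun x : Ext N Y n => (Ext.mk₀ f).comp x (zero_add n)) ∘
    (fun x : Ext K Y n => (Ext.mk₀ g).comp x (zero_add n)) := by
  ext x; simp

theorem extW_comp {Ys : Set A} {M N K : A} {f : M ⟶ N} {g : N ⟶ K}
    (hf : extW Ys f) (hg : extW Ys g) : extW Ys (f ≫ g) := fun Y hY n hn => by
  rw [extW_comp_fun]; exact (hf Y hY n hn).comp (hg Y hY n hn)

theorem extW_left {Ys : Set A} {M N K : A} {f : M ⟶ N} {g : N ⟶ K}
    (hfg : extW Ys (f ≫ g)) (hg : extW Ys g) : extW Ys f := fun Y hY n hn => by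
  have := hfg Y hY n hn
  rw [extW_comp_fun] at this
  exact (Function.Bijective.of_comp_iff _ (hg Y hY n hn)).1 this

theorem extW_right {Ys : Set A} {M N K : A} {f : M ⟶ N} {g : N ⟶ K}
    (hfg : extW Ys (f ≫ g)) (hf : extW Ys f) : extW Ys g := fun Y hY n hn => by
  have := hfg Y hY n hn
  rw [extW_comp_fun] at this
  exact (Function.Bijective.of_comp_iff' (hf Y hY n hn) _).1 this

theorem extW_retract {Ys : Set A} {M N M' N' : A} {f : M ⟶ N} {g : M' ⟶ N'}
    (h : RetractArrow f g) (hg : extW Ys g) : extW Ys f := fun Y hY n hn => by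
  obtain ⟨h1, h2⟩ := hg Y hY n hn
  have il : h.i.left ≫ h.r.left = 𝟙 _ := h.retract_left
  have ir : h.i.right ≫ h.r.right = 𝟙 _ := h.retract_right
  have iw : h.i.left ≫ g = f ≫ h.i.right := h.i_w
  have rw' : h.r.left ≫ f = g ≫ h.r.right := h.r_w
  constructor
  · refine ext_inj_of fun x hx => ?_
    have h3 : (Ext.mk₀ h.r.right).comp x (zero_add n) = 0 := by
      apply h1
      dsimp only
      erw [Ext.mk₀_comp_mk₀_assoc]
      rw [← rw', ← Ext.mk₀_comp_mk₀_assoc, hx, Ext.comp_zero, Ext.comp_zero]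
    have h4 : (Ext.mk₀ h.i.right).comp ((Ext.mk₀ h.r.right).comp x (zero_add n)) (zero_add n)
        = x := by
      erw [Ext.mk₀_comp_mk₀_assoc, ir, Ext.mk₀_id_comp]
    rw [← h4, h3, Ext.comp_zero]
  · intro x
    obtain ⟨y, hy⟩ := h2 ((Ext.mk₀ h.r.left).comp x (zero_add n))
    refine ⟨(Ext.mk₀ h.i.right).comp y (zero_add n), ?_⟩
    dsimp only at hy ⊢
    erw [Ext.mk₀_comp_mk₀_assoc]
    rw [← iw, ← Ext.mk₀_comp_mk₀_assoc, hy]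
    erw [Ext.mk₀_comp_mk₀_assoc, il, Ext.mk₀_id_comp]

/-- Every `Y ∈ Ys` is a cosyzygy of an object of `Ys`. -/
theorem cosyzygy {Xs Zs Ys : Set A}
    (h : IsCompleteHereditaryCotorsionTriple Xs Zs Ys) (Y : A) (hY : Y ∈ Ys) :
    ∃ T : ShortComplex A, T.ShortExact ∧ T.X₁ ∈ Ys ∧ Injective T.X₂ ∧ T.X₃ = Y := by
  obtain ⟨⟨hXZ, -⟩, ⟨hZY, hc⟩, ⟨-, hh⟩, -⟩ := h
  obtain ⟨Y', Z', f, g, w, hS, hZ', hY'⟩ := (hc Y).1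
  refine ⟨_, hS, hY', ?_, rfl⟩
  dsimp
  have hZY' : Z' ∈ Ys := (hZY.2 _).2 fun Z hZ => extZero_of fun x => by
    obtain ⟨y, hy⟩ := Ext.covariant_sequence_exact₂ _ hS x
      (((hZY.2 _).1 hY Z hZ).eq0 _)
    rw [← hy, ((hZY.2 _).1 hY' Z hZ).eq0 y, Ext.zero_comp]
  let j := Injective.ι Z'
  have hC : cokernel j ∈ Zs := (hXZ.2 _).2 fun X hX => extZero_of fun x => by
    obtain ⟨y, hy⟩ := Ext.covariant_sequence_exact₃ _ (cokerSE j) x (n₁ := 2) rfl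
      ((hh X hX Z' hZ' 2 (by lia)).eq0 _)
    rw [← hy, (extZero_inj (I := Injective.under Z') (le_refl 1)).eq0 y, Ext.zero_comp]
  obtain ⟨r', hr'⟩ := Ext.contravariant_sequence_exact₁ (cokerSE j) _ (Ext.mk₀ (𝟙 Z')) (n₁ := 1)
    rfl (((hZY.1 _).1 hC _ hZY').eq0 _)
  obtain ⟨r, rfl⟩ := (Ext.mk₀_bijective _ _).2 r'
  dsimp at hr'
  rw [Ext.mk₀_comp_mk₀] at hr'
  have hr := (Ext.mk₀_bijective _ _).1 hr'
  refine ⟨fun {P Q} a b hb => ?_⟩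
  refine ⟨Injective.factorThru (a ≫ j) b ≫ r, ?_⟩
  rw [← Category.assoc, Injective.comp_factorThru, Category.assoc, hr, Category.comp_id]

theorem extW_of_mono {Xs Zs Ys : Set A}
    (_h : IsCompleteHereditaryCotorsionTriple Xs Zs Ys) {M N : A} (i : M ⟶ N) [Mono i] [Projective (cokernel i)] : extW Ys i := by
  intro Y hY n hn
  constructor
  · refine ext_inj_of fun x hx => ?_
    obtain ⟨y, hy⟩ := Ext.contravariant_sequence_exact₂ (cokerSE i) _ x hx
    rw [← hy, (extZero_proj (P := cokernel i) hn).eq0 y, Ext.comp_zero]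
  · intro x
    exact Ext.contravariant_sequence_exact₁ (cokerSE i) _ x (n₁ := 1 + n) rfl
      ((extZero_proj (P := cokernel i) (by lia)).eq0 _)

theorem extW_of_epi {Xs Zs Ys : Set A}
    (h : IsCompleteHereditaryCotorsionTriple Xs Zs Ys) {M N : A} (p : M ⟶ N) [Epi p] (hk : kernel p ∈ Zs) : extW Ys p := by
  have hh := h.2.2.2.2
  have inj2 : ∀ Y ∈ Ys, ∀ n, 2 ≤ n → ∀ x : Ext N Y n,
      (Ext.mk₀ p).comp x (zero_add n) = 0 → x = 0 := by
    intro Y hY n hn x hx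
    obtain ⟨k, rfl⟩ := Nat.exists_eq_add_of_le hn
    obtain ⟨y, hy⟩ := Ext.contravariant_sequence_exact₃ (kerSE p) _ x hx (n₀ := 1 + k) (by lia)
    rw [← hy, (hh _ hk Y hY _ (by lia)).eq0 y, Ext.comp_zero]
  intro Y hY n hn
  constructor
  · refine ext_inj_of fun x hx => ?_
    obtain ⟨T, hT, hT1, hT2, rfl⟩ := cosyzygy h Y hY
    have h0 : x.comp hT.extClass (rfl : n + 1 = n + 1) = 0 := by
      apply inj2 _ hT1 _ (by lia)
      rw [← Ext.comp_assoc _ _ _ (zero_add n) rfl (by lia), hx, Ext.zero_comp]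
    obtain ⟨y, hy⟩ := Ext.covariant_sequence_exact₃ _ hT x rfl h0
    rw [← hy, (extZero_inj (I := T.X₂) hn).eq0 y, Ext.zero_comp]
  · intro x
    obtain ⟨y, hy⟩ := Ext.contravariant_sequence_exact₂ (kerSE p) _ x
      ((hh _ hk Y hY n hn).eq0 _)
    exact ⟨y, hy⟩

theorem kernel_mem_of_extW {Xs Zs Ys : Set A}
    (h : IsCompleteHereditaryCotorsionTriple Xs Zs Ys) {M N : A} (p : M ⟶ N) [Epi p] (hp : extW Ys p) : kernel p ∈ Zs := by
  refine (h.2.1.1.1 _).2 fun Y hY => extZero_of fun x => ?_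
  have h0 : (kerSE p).extClass.comp x (rfl : 1 + 1 = 2) = 0 := by
    apply (hp Y hY 2 (by lia)).1
    have := (kerSE p).comp_extClass
    dsimp at this ⊢
    rw [← Ext.comp_assoc _ _ _ (zero_add 1) rfl (by lia), this, Ext.zero_comp, Ext.comp_zero]
  obtain ⟨y, hy⟩ := Ext.contravariant_sequence_exact₁ (kerSE p) _ x rfl h0
  obtain ⟨z, hz⟩ := (hp Y hY 1 (by lia)).2 y
  dsimp at hz hy
  rw [← hy, ← hz, Ext.mk₀_comp_mk₀_assoc, kernel.condition]
  simp

theorem coker_mem_of_extW {Xs Zs Ys : Set A}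
    (h : IsCompleteHereditaryCotorsionTriple Xs Zs Ys) {M N : A} (i : M ⟶ N) [Mono i] (hi : extW Ys i) :
    cokernel i ∈ Zs := by
  have e2 : ∀ Y ∈ Ys, extZero (cokernel i) Y 2 := fun Y hY => extZero_of fun x => by
    have h0 : (Ext.mk₀ (cokernel.π i)).comp x (zero_add 2) = 0 := by
      apply (hi Y hY 2 (by lia)).1
      dsimp only
      rw [Ext.mk₀_comp_mk₀_assoc, cokernel.condition]
      simp
    obtain ⟨y, hy⟩ := Ext.contravariant_sequence_exact₃ (cokerSE i) _ x h0 (n₀ := 1) rfl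
    obtain ⟨z, hz⟩ := (hi Y hY 1 (by lia)).2 y
    have := (cokerSE i).extClass_comp
    dsimp at hz hy this
    rw [← hy, ← hz, ← Ext.comp_assoc _ _ _ (add_zero 1) rfl (by lia), this, Ext.zero_comp]
  refine (h.2.1.1.1 _).2 fun Y hY => extZero_of fun x => ?_
  obtain ⟨T, hT, hT1, hT2, rfl⟩ := cosyzygy h Y hY
  obtain ⟨y, hy⟩ := Ext.covariant_sequence_exact₃ _ hT x (rfl : 1 + 1 = 2) ((e2 _ hT1).eq0 _)
  rw [← hy, (extZero_inj (I := T.X₂) (le_refl 1)).eq0 y, Ext.zero_comp]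

theorem factor_proj {M N : A} (f : M ⟶ N) :
    ∃ (K : A) (i : M ⟶ K) (p : K ⟶ N), i ≫ p = f ∧ Mono i ∧ Projective (cokernel i) ∧ Epi p := by
  refine ⟨M ⊞ Projective.over N, biprod.inl, biprod.desc f (Projective.π N), by simp,
    inferInstance, Projective.of_iso (cokernelBiprodInlIso).symm inferInstance, ?_⟩
  have : Epi ((biprod.inr : _ ⟶ M ⊞ Projective.over N) ≫ biprod.desc f (Projective.π N)) := by
    rw [biprod.inr_desc]; infer_instance
  exact epi_of_epi biprod.inr _

theorem projW_iff {Xs Zs Ys : Set A}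
    (h : IsCompleteHereditaryCotorsionTriple Xs Zs Ys) {M N : A} (f : M ⟶ N) : projW Zs f ↔ extW Ys f := by
  constructor
  · rintro ⟨K, i, p, rfl, hi, hP, hp, hk⟩
    exact extW_comp (extW_of_mono h i) (extW_of_epi h p hk)
  · intro hf
    obtain ⟨K, i, p, rfl, hi, hP, hp⟩ := factor_proj f
    exact ⟨K, i, p, rfl, hi, hP, hp,
      kernel_mem_of_extW h p (extW_right hf (extW_of_mono h i))⟩

theorem proj_mem_X {Xs Zs Ys : Set A}
    (h : IsCompleteHereditaryCotorsionTriple Xs Zs Ys) (P : A) [Projective P] : P ∈ Xs :=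
  (h.1.1.1 _).2 fun _ _ => extZero_proj (le_refl 1)

theorem proj_mem_Z {Xs Zs Ys : Set A}
    (h : IsCompleteHereditaryCotorsionTriple Xs Zs Ys) (P : A) [Projective P] : P ∈ Zs :=
  (h.2.1.1.1 _).2 fun _ _ => extZero_proj (le_refl 1)

/-- `Xs ∩ Zs` consists of projectives. -/
theorem proj_of_mem {Xs Zs Ys : Set A}
    (h : IsCompleteHereditaryCotorsionTriple Xs Zs Ys) (C : A) (hX : C ∈ Xs) (hZ : C ∈ Zs) : Projective C := by
  let p := Projective.π C
  have hK : kernel p ∈ Zs := (h.2.1.1.1 _).2 fun Y hY => extZero_of fun x => by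
    obtain ⟨y, hy⟩ := Ext.contravariant_sequence_exact₁ (kerSE p) _ x (rfl : 1 + 1 = 2)
      ((h.2.2.2.2 _ hZ Y hY 2 (by lia)).eq0 _)
    rw [← hy, (extZero_proj (P := Projective.over C) (le_refl 1)).eq0 y, Ext.comp_zero]
  obtain ⟨s', hs'⟩ := Ext.covariant_sequence_exact₃ _ (kerSE p) (Ext.mk₀ (𝟙 C))
    (rfl : 0 + 1 = 1) (((h.1.1.1 _).1 hX _ hK).eq0 _)
  obtain ⟨s, rfl⟩ := (Ext.mk₀_bijective _ _).2 s'
  dsimp at hs'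
  rw [Ext.mk₀_comp_mk₀] at hs'
  have hs := (Ext.mk₀_bijective _ _).1 hs'
  refine ⟨fun {E B} a e he => ⟨s ≫ Projective.factorThru (p ≫ a) e, ?_⟩⟩
  rw [Category.assoc, Projective.factorThru_comp, ← Category.assoc, hs, Category.id_comp]

theorem factor_cof {Xs Zs Ys : Set A}
    (h : IsCompleteHereditaryCotorsionTriple Xs Zs Ys) {M N : A} (f : M ⟶ N) :
    ∃ (Q : A) (i : M ⟶ Q) (p : Q ⟶ N), projCof Xs i ∧ Epi p ∧ projW Zs p ∧ i ≫ p = f := by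
  obtain ⟨K, i, p, rfl, hi, hP, hp⟩ := factor_proj f
  have hXZ := h.1.1
  obtain ⟨Z', X', a, b, w, hS, hX', hZ'⟩ := (h.1.2 (kernel p)).2
  have ha : Mono a := hS.mono_f
  have hal : (epiKer Zs).llp a := fun {U V} q hq => by
    have := hq.1
    exact lift_of_ext hS (kerSE q) ((hXZ.1 _).1 hX' _ hq.2)
  let k := kernel.ι p
  let q : pushout k a ⟶ N := pushout.desc p 0 (by simp [k])
  have hq : pushout.inl k a ≫ q = p := pushout.inl_desc _ _ _
  have hq0 : pushout.inr k a ≫ q = 0 := pushout.inr_desc _ _ _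
  have hqe : Epi q := by
    have : Epi (pushout.inl k a ≫ q) := by rw [hq]; exact hp
    exact epi_of_epi (pushout.inl k a) q
  have hT : (ShortComplex.mk (pushout.inr k a) q hq0).ShortExact := by
    refine { exact := ShortComplex.exact_of_g_is_cokernel _ ?_ }
    refine CokernelCofork.IsColimit.ofπ _ _
      (fun {T} g hg => (kerSE p).exact.desc (pushout.inl k a ≫ g) ?_) ?_ ?_
    · dsimp
      rw [← Category.assoc]
      erw [pushout.condition]
      rw [Category.assoc]
      erw [hg]
      simp
    · intro T g hg
      apply pushout.hom_ext
      · rw [← Category.assoc, hq]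
        exact (kerSE p).exact.g_desc _ _
      · rw [← Category.assoc, hq0]
        simpa using hg.symm
    · intro T g hg m hm
      have hd := (kerSE p).exact.g_desc (pushout.inl k a ≫ g)
      dsimp at hd
      have hpm : p ≫ m = pushout.inl k a ≫ g := by
        have h1 : (pushout.inl k a ≫ q) ≫ m = p ≫ m := congrArg (fun t => t ≫ m) hq
        rw [← h1, Category.assoc]
        exact congrArg (fun t => pushout.inl k a ≫ t) hm
      rw [← cancel_epi p, hd, hpm]
  have hker : kernel q ∈ Zs := by
    refine (hXZ.2 _).2 fun X hX => extZero_iso_right ?_ ((hXZ.2 _).1 hZ' X hX)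
    exact hT.fIsKernel.conePointUniqueUpToIso (limit.isLimit _)
  refine ⟨_, i ≫ pushout.inl k a, q, (projCof_iff hXZ _).2 ⟨inferInstance, ?_⟩, hqe,
    (projW_iff h _).2 (extW_of_epi h q hker), by rw [Category.assoc, hq]⟩
  refine MorphismProperty.comp_mem _ _ _ ?_ ?_
  · exact ((projCof_iff hXZ i).1 ⟨hi, proj_mem_X h _⟩).2
  · exact MorphismProperty.of_isPushout (IsPushout.of_hasPushout k a) hal

/-- Let `𝒜` be a bicomplete abelian category with a complete hereditary cotorsion
triple `(𝒳, 𝒵, 𝒴)`. Then the projective classes form a Quillen model structure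
on `𝒜`, in which the cofibrant objects are exactly the objects of `𝒳`, every
object is fibrant, and `M` is trivial exactly when `M ∈ 𝒵`. -/
theorem projective_model_structure [HasLimits A] [HasColimits A]
    (Xs Zs Ys : Set A) (h : IsCompleteHereditaryCotorsionTriple Xs Zs Ys) :
    IsModelStructure (projW Zs) (projCof Xs) projFib ∧
    (∀ M : A, projCof Xs (0 : (0 : A) ⟶ M) ↔ M ∈ Xs) ∧
    (∀ M : A, projFib (0 : M ⟶ (0 : A))) ∧
    (∀ M : A, projW Zs (0 : (0 : A) ⟶ M) ↔ M ∈ Zs) := by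
  have hXZ := h.1.1
  refine ⟨⟨?_, ?_, ?_, ?_, ?_, ?_, ?_, ?_, ?_, ?_⟩, ?_, ?_, ?_⟩
  · intro X Y Z f g hf hg
    rw [projW_iff h] at *
    exact extW_comp hf hg
  · intro X Y Z f g hf hg
    rw [projW_iff h] at *
    exact extW_left hf hg
  · intro X Y Z f g hf hg
    rw [projW_iff h] at *
    exact extW_right hf hg
  · rintro X₁ Y₁ X₂ Y₂ f g ⟨i, r, hir⟩ hg
    rw [projW_iff h] at *
    exact extW_retract ⟨i, r, hir⟩ hg
  · rintro X₁ Y₁ X₂ Y₂ f g ⟨i, r, hir⟩ hg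
    rw [projCof_iff hXZ] at *
    have ra : RetractArrow f g := ⟨i, r, hir⟩
    exact ⟨MorphismProperty.of_retract (P := MorphismProperty.monomorphisms A) ra hg.1,
      MorphismProperty.of_retract ra hg.2⟩
  · rintro X₁ Y₁ X₂ Y₂ f g ⟨i, r, hir⟩ hg
    have ra : RetractArrow f g := ⟨i, r, hir⟩
    exact MorphismProperty.of_retract (P := MorphismProperty.epimorphisms A) ra hg
  · intro X₁ Y₁ X₂ Y₂ i p hi hW hp
    have := hi.1
    have : Epi p := hp
    have := proj_of_mem h _ hi.2 (coker_mem_of_extW h i ((projW_iff h i).1 hW))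
    exact lift_of_ext (cokerSE i) (kerSE p) (extZero_proj (P := cokernel i) (le_refl 1))
  · intro X₁ Y₁ X₂ Y₂ i p hi hp hW
    have : Epi p := hp
    exact ((projCof_iff hXZ i).1 hi).2 p ⟨hp, kernel_mem_of_extW h p ((projW_iff h p).1 hW)⟩
  · intro X Y f
    obtain ⟨K, i, p, rfl, hi, hP, hp⟩ := factor_proj f
    exact ⟨K, i, p, ⟨hi, proj_mem_X h _⟩, (projW_iff h i).2 (extW_of_mono h i), hp, rfl⟩
  · intro X Y f
    exact factor_cof h f
  · intro M
    have e : cokernel (0 : (0 : A) ⟶ M) ≅ M := cokernelZeroIsoTarget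
    constructor
    · rintro ⟨-, hc⟩
      exact (hXZ.1 _).2 fun Z hZ => extZero_iso_left e ((hXZ.1 _).1 hc Z hZ)
    · intro hM
      exact ⟨inferInstance, (hXZ.1 _).2 fun Z hZ => extZero_iso_left e.symm ((hXZ.1 _).1 hM Z hZ)⟩
  · intro M
    exact (inferInstance : Epi (0 : M ⟶ (0 : A)))
  · intro M
    have hz : ∀ (Y : A) (n : ℕ), extZero (0 : A) Y n := fun Y n => extZero_of fun x => by
      rw [← Ext.mk₀_id_comp x, (isZero_zero A).eq_of_src (𝟙 (0 : A)) 0]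
      simp
    rw [projW_iff h]
    constructor
    · intro hW
      refine (h.2.1.1.1 _).2 fun Y hY => extZero_of fun x => ?_
      exact (hW Y hY 1 (le_refl 1)).1 ((hz Y 1).elim _ _)
    · intro hM Y hY n hn
      refine ⟨fun a b _ => (h.2.2.2.2 M hM Y hY n hn).elim _ _, fun x => ⟨0, (hz Y n).elim _ _⟩⟩
end

section
/- Let (𝒳, 𝒵, 𝒴) be a complete hereditary cotorsion triple in 𝒜, let X ∈ 𝒳, Y ∈ 𝒴 and let f : X → Y be a morphism. Then f admits a factorization f = p ∘ i where i is a monomorphism with projective cokernel and p is an epimorphism with kernel in 𝒵, if and only if f admits a factorization f = p' ∘ i' where i' is a monomorphism with cokernel in 𝒵 and p' is an epimorphism with injective kernel. (That is, f is a weak equivalence in the projective model structure if and only if it is one in the injective model structure.) -/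
open CategoryTheory Abelian Limits ZeroObject

universe v u

variable {A : Type u} [Category.{v} A] [Abelian A]
  [EnoughProjectives A] [EnoughInjectives A]

section Helpers

open kernelCokernelCompSequence

variable {B : Type u} [Category.{v} B] [Abelian B]

lemma sesK {P Q R : B} (f : P ⟶ Q) (g : Q ⟶ R) [Epi f] :
    (snakeInput f g).L₀.ShortExact where
  exact := (snakeInput f g).L₀_exact
  mono_f := by
    change Mono (kernel.map f (f ≫ g) (𝟙 _) g (by simp))
    infer_instance
  epi_g := (snakeInput f g).L₁'_exact.epi_f ((isZero_cokernel_of_epi f).eq_of_tgt _ _)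

lemma sesC {P Q R : B} (f : P ⟶ Q) (g : Q ⟶ R) [Mono g] :
    (snakeInput f g).L₃.ShortExact where
  exact := (snakeInput f g).L₃_exact
  mono_f := (snakeInput f g).L₂'_exact.mono_g ((isZero_kernel_of_mono g).eq_of_src _ _)
  epi_g := by
    change Epi (cokernel.map (f ≫ g) g f (𝟙 _) (by simp))
    infer_instance

lemma sesM {P Q R : B} (f : P ⟶ Q) (g : Q ⟶ R) (h1 : Mono (f ≫ g)) [Epi g] :
    (snakeInput f g).L₂'.ShortExact where
  exact := (snakeInput f g).L₂'_exact
  mono_f := (snakeInput f g).L₁'_exact.mono_g ((isZero_kernel_of_mono (f ≫ g)).eq_of_src _ _)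
  epi_g := (snakeInput f g).L₃_exact.epi_f ((isZero_cokernel_of_epi g).eq_of_tgt _ _)

lemma sesM' {P Q R : B} (f : P ⟶ Q) (g : Q ⟶ R) (h1 : Epi (f ≫ g)) [Mono f] :
    (snakeInput f g).L₁'.ShortExact where
  exact := (snakeInput f g).L₁'_exact
  mono_f := (snakeInput f g).L₀_exact.mono_g ((isZero_kernel_of_mono f).eq_of_src _ _)
  epi_g := (snakeInput f g).L₂'_exact.epi_f ((isZero_cokernel_of_epi (f ≫ g)).eq_of_tgt _ _)

end Helpers

section Thick

variable {Xs Zs Ys : Set A}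

lemma extZero_eq {M N : A} {n : ℕ} (h : extZero M N n) (x : Abelian.Ext M N n) : x = 0 :=
  h.elim _ _

lemma thick_ext (h : IsCotorsionPair Xs Zs) {S : ShortComplex A} (hS : S.ShortExact)
    (h1 : S.X₁ ∈ Zs) (h3 : S.X₃ ∈ Zs) : S.X₂ ∈ Zs := by
  rw [h.2] at *
  intro X' hX'
  refine ⟨fun a b => sub_eq_zero.1 ?_⟩
  obtain ⟨y, hy⟩ := Ext.covariant_sequence_exact₂ X' hS (a - b) (extZero_eq (h3 X' hX') _)
  rw [← hy, extZero_eq (h1 X' hX') y, Ext.zero_comp]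

lemma thick_coker (h : IsHereditaryCotorsionPair Xs Zs) {S : ShortComplex A} (hS : S.ShortExact)
    (h1 : S.X₁ ∈ Zs) (h2 : S.X₂ ∈ Zs) : S.X₃ ∈ Zs := by
  rw [h.1.2]
  intro X' hX'
  refine ⟨fun a b => sub_eq_zero.1 ?_⟩
  obtain ⟨y, hy⟩ := Ext.covariant_sequence_exact₃ X' hS (a - b) (n₁ := 2) rfl
    (extZero_eq (h.2 X' hX' _ h1 2 (by norm_num)) _)
  rw [← hy, extZero_eq (h.2 X' hX' _ h2 1 le_rfl) y, Ext.zero_comp]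

lemma thick_ker (h : IsHereditaryCotorsionPair Zs Ys) {S : ShortComplex A} (hS : S.ShortExact)
    (h2 : S.X₂ ∈ Zs) (h3 : S.X₃ ∈ Zs) : S.X₁ ∈ Zs := by
  rw [h.1.1]
  intro Y' hY'
  refine ⟨fun a b => sub_eq_zero.1 ?_⟩
  obtain ⟨y, hy⟩ := Ext.contravariant_sequence_exact₁ hS Y' (a - b) (n₁ := 2) rfl
    (extZero_eq (h.2 _ h3 Y' hY' 2 (by norm_num)) _)
  rw [← hy, extZero_eq (h.2 _ h2 Y' hY' 1 le_rfl) y, Ext.comp_zero]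

lemma inj_mem (h : IsCotorsionPair Xs Zs) (I : A) [Injective I] : I ∈ Zs := by
  rw [h.2]
  intro X' _
  exact ⟨fun a b => (Ext.eq_zero_of_injective a).trans (Ext.eq_zero_of_injective b).symm⟩

lemma proj_mem (h : IsCotorsionPair Zs Ys) (P : A) [Projective P] : P ∈ Zs := by
  rw [h.1]
  intro X' _
  exact ⟨fun a b => (Ext.eq_zero_of_projective a).trans (Ext.eq_zero_of_projective b).symm⟩

end Thick

/-- For a complete hereditary cotorsion triple `(𝒳, 𝒵, 𝒴)`, `X ∈ 𝒳`, `Y ∈ 𝒴` and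
`f : X ⟶ Y`, the morphism `f` factors as (mono with projective cokernel) ≫ (epi with
kernel in `𝒵`) iff it factors as (mono with cokernel in `𝒵`) ≫ (epi with injective
kernel); i.e. `f` is a weak equivalence in the projective model structure iff it is
one in the injective model structure. -/
theorem weakEquiv_proj_iff_inj (Xs Zs Ys : Set A)
    (h : IsCompleteHereditaryCotorsionTriple Xs Zs Ys)
    {X Y : A} (hX : X ∈ Xs) (hY : Y ∈ Ys) (f : X ⟶ Y) :
    (∃ (M : A) (i : X ⟶ M) (p : M ⟶ Y),
        i ≫ p = f ∧ Mono i ∧ Projective (cokernel i) ∧ Epi p ∧ kernel p ∈ Zs) ↔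
    (∃ (M : A) (i : X ⟶ M) (p : M ⟶ Y),
        i ≫ p = f ∧ Mono i ∧ cokernel i ∈ Zs ∧ Epi p ∧ Injective (kernel p)) := by
  obtain ⟨-, -, hXZ, hZY⟩ := h
  constructor
  · rintro ⟨M, i, p, rfl, hi, hP, hp, hK⟩
    let I := Injective.under X
    let j : X ⟶ I := Injective.ι X
    have hI : I ∈ Zs := inj_mem hXZ.1 I
    have kI : ∀ N : A, Injective (kernel (biprod.snd : I ⊞ N ⟶ N)) := fun N =>
      Injective.of_iso kernelBiprodSndIso.symm inferInstance
    have kZ : ∀ N : A, kernel (biprod.snd : I ⊞ N ⟶ N) ∈ Zs := fun N =>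
      have := kI N
      inj_mem hXZ.1 _
    let m : I ⊞ M ⟶ I ⊞ Y := biprod.map (𝟙 I) p
    have hm : Epi m := by dsimp [m]; infer_instance
    let a : X ⟶ I ⊞ M := biprod.lift j i
    have ham : a ≫ m = biprod.lift j (i ≫ p) := by
      dsimp only [a, m]; ext <;> simp
    have has : a ≫ biprod.snd = i := by simp [a]
    have hamono : Mono (a ≫ m) := by
      have : Mono ((a ≫ m) ≫ biprod.fst) := by rw [ham, biprod.lift_fst]; dsimp [j]; infer_instance
      exact mono_of_mono _ biprod.fst
    -- cokernel of `a`
    have hca : cokernel a ∈ Zs := by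
      have hmono : Mono (a ≫ (biprod.snd : I ⊞ M ⟶ M)) := by rw [has]; exact hi
      refine thick_ext hXZ.1 (sesM a biprod.snd hmono) (kZ M) ?_
      change cokernel (a ≫ biprod.snd) ∈ Zs
      rw [has]
      exact proj_mem hZY.1 _
    -- kernel of `m`
    have hms : m ≫ biprod.snd = biprod.snd ≫ p := by simp [m]
    have hkm : kernel m ∈ Zs := by
      refine thick_ker hZY (sesK m (biprod.snd : I ⊞ Y ⟶ Y)) ?_ (kZ Y)
      change kernel (m ≫ biprod.snd) ∈ Zs
      rw [hms]
      exact thick_ext hXZ.1 (sesK (biprod.snd : I ⊞ M ⟶ M) p) (kZ M) hK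
    refine ⟨I ⊞ Y, a ≫ m, biprod.snd, ?_, hamono, ?_, inferInstance, kI Y⟩
    · rw [Category.assoc, hms, ← Category.assoc, has]
    · exact thick_coker hXZ (sesM a m hamono) hkm hca
  · rintro ⟨N, i, p, rfl, hi, hC, hp, hK⟩
    let P := Projective.over Y
    let q : P ⟶ Y := Projective.π Y
    have hP : P ∈ Zs := proj_mem hZY.1 P
    have kP : ∀ N : A, Projective (cokernel (biprod.inl : N ⟶ N ⊞ P)) := fun N =>
      Projective.of_iso cokernelBiprodInlIso.symm inferInstance
    have kZ : ∀ N : A, cokernel (biprod.inl : N ⟶ N ⊞ P) ∈ Zs := fun N =>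
      have := kP N
      proj_mem hZY.1 _
    let m : X ⊞ P ⟶ N ⊞ P := biprod.map i (𝟙 P)
    have hm : Mono m := by dsimp [m]; infer_instance
    let b : N ⊞ P ⟶ Y := biprod.desc p q
    have hmb : m ≫ b = biprod.desc (i ≫ p) q := by
      dsimp only [b, m]; ext <;> simp
    have hib : biprod.inl ≫ b = p := by simp [b]
    have hbepi : Epi (m ≫ b) := by
      have : Epi (biprod.inr ≫ (m ≫ b)) := by rw [hmb, biprod.inr_desc]; dsimp [q]; infer_instance
      exact epi_of_epi biprod.inr _
    have hkb : kernel b ∈ Zs := by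
      have hepi : Epi ((biprod.inl : N ⟶ N ⊞ P) ≫ b) := by rw [hib]; exact hp
      refine thick_ext hXZ.1 (sesM' biprod.inl b hepi) ?_ (kZ N)
      change kernel (biprod.inl ≫ b) ∈ Zs
      rw [hib]
      exact inj_mem hXZ.1 _
    have hms : biprod.inl ≫ m = i ≫ biprod.inl := by simp [m]
    have hcm : cokernel m ∈ Zs := by
      refine thick_coker hXZ (sesC (biprod.inl : X ⟶ X ⊞ P) m) (kZ X) ?_
      change cokernel (biprod.inl ≫ m) ∈ Zs
      rw [hms]
      exact thick_ext hXZ.1 (sesC i (biprod.inl : N ⟶ N ⊞ P)) hC (kZ N)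
    refine ⟨X ⊞ P, biprod.inl, m ≫ b, ?_, inferInstance, kP X, hbepi, ?_⟩
    · rw [← Category.assoc, hms, Category.assoc, hib]
    · exact thick_ker hZY (sesM' m b hbepi) hkb hcm
end

section
/- Let (𝒳, 𝒵, 𝒴) be a complete hereditary cotorsion triple in 𝒜 and let N ∈ 𝒵. Suppose 0 → N → Y⁰ → Y¹ → Y² → ⋯ is an exact sequence in 𝒜 with every Y^j ∈ 𝒴 and with every cosyzygy in 𝒵 (i.e., Coker(N → Y⁰) ∈ 𝒵 and Coker(Y^{j-1} → Y^j) ∈ 𝒵 for all j ≥ 1). Then every Y^j is an injective object; consequently this sequence is an injective coresolution of N, and for every object M and every i ≥ 0 the i-th cohomology of the complex Hom(M, Y•) is naturally isomorphic to Ext^i(M, N). -/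
open CategoryTheory Abelian Limits ZeroObject

universe v u

variable {A : Type u} [Category.{v} A] [Abelian A]
  [EnoughProjectives A] [EnoughInjectives A]

set_option linter.unusedSectionVars false

lemma extZero_middle (X : A) {S : ShortComplex A} (hS : S.ShortExact) (n : ℕ)
    (h1 : extZero X S.X₁ n) (h3 : extZero X S.X₃ n) : extZero X S.X₂ n := by
  unfold extZero at *
  refine subsingleton_of_forall_eq 0 fun x => ?_
  obtain ⟨y, rfl⟩ := Ext.covariant_sequence_exact₂ X hS x (Subsingleton.elim _ _)
  rw [Subsingleton.elim y 0, Ext.zero_comp]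

lemma extZero_right (X : A) {S : ShortComplex A} (hS : S.ShortExact) (n : ℕ)
    (h2 : extZero X S.X₂ n) (h1 : extZero X S.X₁ (n + 1)) : extZero X S.X₃ n := by
  unfold extZero at *
  refine subsingleton_of_forall_eq 0 fun x => ?_
  obtain ⟨y, rfl⟩ := Ext.covariant_sequence_exact₃ X hS x rfl (Subsingleton.elim _ _)
  rw [Subsingleton.elim y 0, Ext.zero_comp]

lemma split_of_extZero {S : ShortComplex A} (hS : S.ShortExact)
    (h : extZero S.X₃ S.X₁ 1) : ∃ r : S.X₂ ⟶ S.X₁, S.f ≫ r = 𝟙 S.X₁ := by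
  unfold extZero at h
  obtain ⟨y, hy⟩ := Ext.contravariant_sequence_exact₁ hS (Y := S.X₁) (Ext.mk₀ (𝟙 S.X₁))
    (n₁ := 1) rfl (Subsingleton.elim _ _)
  obtain ⟨r, rfl⟩ := (Ext.mk₀_bijective _ _).2 y
  refine ⟨r, ?_⟩
  rw [Ext.mk₀_comp_mk₀] at hy
  exact (Ext.mk₀_bijective _ _).1 hy

lemma injective_of_mem {Xs Zs Ys : Set A} (hXZ : IsHereditaryCotorsionPair Xs Zs)
    (hZY : IsCotorsionPair Zs Ys) {I : A} (hZ : I ∈ Zs) (hY : I ∈ Ys) : Injective I := by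
  let S : ShortComplex A := ShortComplex.mk (Injective.ι I) (cokernel.π (Injective.ι I)) (by simp)
  have hS : S.ShortExact :=
    { exact := ShortComplex.exact_of_g_is_cokernel _ (cokernelIsCokernel _)
      mono_f := inferInstanceAs (Mono (Injective.ι I))
      epi_g := inferInstanceAs (Epi (cokernel.π _)) }
  have hC : S.X₃ ∈ Zs := (hXZ.1.2 _).2 fun X' hX' =>
    extZero_right X' hS 1 (Ext.subsingleton_of_injective X' (Injective.under I) 0)
      (hXZ.2 X' hX' I hZ 2 (by norm_num))
  obtain ⟨r, hr⟩ := split_of_extZero hS ((hZY.2 I).1 hY _ hC)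
  have hr' : Injective.ι I ≫ (r : Injective.under I ⟶ I) = 𝟙 I := hr
  exact ⟨fun g f hf => ⟨Injective.factorThru (g ≫ Injective.ι I) f ≫ (r : Injective.under I ⟶ I), by
    rw [← Category.assoc, Injective.comp_factorThru, Category.assoc, hr', Category.comp_id]⟩⟩

lemma mem_of_shortExact {Xs Zs : Set A} (hXZ : IsCotorsionPair Xs Zs)
    {S : ShortComplex A} (hS : S.ShortExact) (h1 : S.X₁ ∈ Zs) (h3 : S.X₃ ∈ Zs) : S.X₂ ∈ Zs :=
  (hXZ.2 _).2 fun X' hX' => extZero_middle X' hS 1 ((hXZ.2 _).1 h1 X' hX') ((hXZ.2 _).1 h3 X' hX')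

lemma mem_of_exact {Xs Zs : Set A} (hXZ : IsCotorsionPair Xs Zs) {P Q R : A}
    (a : P ⟶ Q) (b : Q ⟶ R) (w : a ≫ b = 0) (hex : (ShortComplex.mk a b w).Exact)
    (ha : cokernel a ∈ Zs) (hb : cokernel b ∈ Zs) : R ∈ Zs := by
  have hm : Mono (cokernel.desc a b w) := hex.mono_cokernelDesc
  have hw : cokernel.desc a b w ≫ cokernel.π b = 0 := by
    rw [← cancel_epi (cokernel.π a)]; simp
  let S : ShortComplex A := ShortComplex.mk (cokernel.desc a b w) (cokernel.π b) hw
  have hS : S.ShortExact :=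
    { exact := by
        refine ShortComplex.exact_of_g_is_cokernel _ ?_
        refine CokernelCofork.IsColimit.ofπ _ _ (fun g hg => cokernel.desc b g ?_) ?_ ?_
        · have := congrArg (fun t => cokernel.π a ≫ t) hg
          simpa [S] using this
        · intro _ g hg
          simp [S]
        · intro _ g hg m hm
          rw [← cancel_epi (cokernel.π b)]
          simpa [S] using hm
      mono_f := hm
      epi_g := inferInstanceAs (Epi (cokernel.π b)) }
  exact mem_of_shortExact hXZ hS ha hb

lemma extMk_zero_eq_zero_iff {M N : A} (R : InjectiveResolution N) (f : M ⟶ R.cocomplex.X 0)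
    (hf : f ≫ R.cocomplex.d 0 1 = 0) : R.extMk f 1 rfl hf = 0 ↔ f = 0 := by
  constructor
  · intro h
    rw [← R.extEquivCohomologyClass.apply_eq_iff_eq,
      InjectiveResolution.extEquivCohomologyClass_extMk,
      InjectiveResolution.extEquivCohomologyClass_zero,
      CochainComplex.HomComplex.CohomologyClass.mk_eq_zero_iff] at h
    rw [CochainComplex.HomComplex.Cocycle.fromSingleMk_mem_coboundaries_iff _ _ _ _ _ (-1)
      (by simp)] at h
    obtain ⟨g, hg⟩ := h
    have hz : IsZero (R.cochainComplex.X (-1)) :=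
      CochainComplex.isZero_of_isStrictlyGE _ 0 _ (by lia)
    rw [hz.eq_of_tgt g 0, zero_comp] at hg
    rw [← cancel_mono (R.cochainComplexXIso ((0 : ℕ) : ℤ) 0 rfl).inv, ← hg, zero_comp]
  · rintro rfl
    simp

/-- The homology of `Hom(M, R)` is `Ext(M, N)` for an injective resolution `R` of `N`. -/
lemma homology_addEquiv_ext {M N : A} (R : InjectiveResolution N) (i : ℕ) :
    Nonempty (((((preadditiveCoyoneda.obj (Opposite.op M)).mapHomologicalComplex
      (ComplexShape.up ℕ)).obj R.cocomplex).homology i) ≃+ Abelian.Ext M N i) := by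
  let G := ((preadditiveCoyoneda.obj (Opposite.op M)).mapHomologicalComplex
      (ComplexShape.up ℕ)).obj R.cocomplex
  let S := G.sc i
  have hnext : (ComplexShape.up ℕ).next i = i + 1 := by simp
  have hg : ∀ x : M ⟶ R.cocomplex.X i, x ∈ S.g.hom.ker ↔ x ≫ R.cocomplex.d i (i + 1) = 0 := by
    intro x
    have : x ∈ S.g.hom.ker ↔ x ≫ R.cocomplex.d i ((ComplexShape.up ℕ).next i) = 0 := Iff.rfl
    rw [this, hnext]
  let φ : S.g.hom.ker →+ Ext M N i := AddMonoidHom.mk'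
    (fun x => R.extMk (X := M) x.1 (i + 1) rfl ((hg x.1).1 x.2))
    (fun x y => (R.add_extMk (X := M) x.1 y.1 (i + 1) rfl ((hg x.1).1 x.2) ((hg y.1).1 y.2)).symm)
  have hφ : Function.Surjective φ := by
    intro α
    obtain ⟨f, hf, rfl⟩ := R.extMk_surjective α (i + 1) rfl
    exact ⟨⟨f, (hg f).2 hf⟩, rfl⟩
  have hker : S.abToCycles.range = φ.ker := by
    ext x
    have e1 : x ∈ S.abToCycles.range ↔ ∃ g : M ⟶ R.cocomplex.X ((ComplexShape.up ℕ).prev i),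
        g ≫ R.cocomplex.d ((ComplexShape.up ℕ).prev i) i = x.1 := by
      constructor
      · rintro ⟨g, rfl⟩
        exact ⟨g, rfl⟩
      · rintro ⟨g, hg⟩
        exact ⟨g, Subtype.ext hg⟩
    have e2 : x ∈ φ.ker ↔ R.extMk (X := M) x.1 (i + 1) rfl ((hg x.1).1 x.2) = 0 := Iff.rfl
    rw [e1, e2]
    cases i with
    | zero =>
      refine Iff.trans ?_ (extMk_zero_eq_zero_iff R _ _).symm
      rw [R.cocomplex.shape _ _ (by simp)]
      simp only [comp_zero, exists_const]
      exact eq_comm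
    | succ p =>
      refine Iff.trans ?_ (R.extMk_eq_zero_iff _ _ _ _ p rfl).symm
      have hp : (ComplexShape.up ℕ).prev (p + 1) = p := by simp
      rw [hp]
  exact ⟨S.abHomologyIso.addCommGroupIsoToAddEquiv.trans
    ((QuotientAddGroup.quotientAddEquivOfEq hker).trans
      (QuotientAddGroup.quotientKerEquivOfSurjective φ hφ))⟩

/-- Build an injective resolution from exactness data. -/
lemma exists_injectiveResolution {N : A} (K : CochainComplex A ℕ) (hK : ∀ n, Injective (K.X n))
    (f : N ⟶ K.X 0) (hf : Mono f) (w0 : f ≫ K.d 0 1 = 0)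
    (hex0 : (ShortComplex.mk f (K.d 0 1) w0).Exact)
    (hex : ∀ n, K.ExactAt (n + 1)) : ∃ R : InjectiveResolution N, R.cocomplex = K :=
  ⟨{ cocomplex := K
     injective := hK
     ι := (CochainComplex.fromSingle₀Equiv _ _).symm ⟨f, w0⟩
     quasiIso := ⟨fun n => by
      cases n with
      | zero =>
        rw [CochainComplex.quasiIsoAt₀_iff, ShortComplex.quasiIso_iff_of_zeros]
        · refine (ShortComplex.exact_and_mono_f_iff_of_iso ?_).2 ⟨hex0, hf⟩
          exact ShortComplex.isoMk (Iso.refl _) (Iso.refl _) (Iso.refl _) 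
            (by simp; exact (Category.id_comp f).trans (Category.comp_id f).symm)
            ((Category.id_comp (K.d 0 1)).trans (Category.comp_id (K.d 0 1)).symm)
        · rfl
        · rfl
        · exact K.shape _ _ (by simp)
      | succ n =>
        rw [quasiIsoAt_iff_exactAt]
        · exact hex n
        · exact HomologicalComplex.exactAt_single_obj _ _ _ _ (by simp)⟩ }, rfl⟩

/-- Let `(𝒳, 𝒵, 𝒴)` be a complete hereditary cotorsion triple, `N ∈ 𝒵`, and let
`0 → N → Y⁰ → Y¹ → ⋯` be an exact sequence with every `Y^j ∈ 𝒴` and every cosyzygy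
in `𝒵`. Then every `Y^j` is injective; consequently, for every object `M` and
every `i ≥ 0`, the `i`-th cohomology of the complex `Hom(M, Y•)` is isomorphic to
`Ext^i(M, N)`. -/
theorem coresolution_injective (Xs Zs Ys : Set A)
    (h : IsCompleteHereditaryCotorsionTriple Xs Zs Ys)
    (N : A) (hN : N ∈ Zs)
    (Y : ℕ → A) (d : ∀ j, Y j ⟶ Y (j + 1)) (f : N ⟶ Y 0)
    (hf : Mono f) (w0 : f ≫ d 0 = 0) (w : ∀ j, d j ≫ d (j + 1) = 0)
    (hex0 : (ShortComplex.mk f (d 0) w0).Exact)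
    (hex : ∀ j, (ShortComplex.mk (d j) (d (j + 1)) (w j)).Exact)
    (hY : ∀ j, Y j ∈ Ys)
    (hcosyz0 : cokernel f ∈ Zs) (hcosyz : ∀ j, cokernel (d j) ∈ Zs) :
    (∀ j, Injective (Y j)) ∧
      ∀ (M : A) (i : ℕ),
        Nonempty
          (((((preadditiveCoyoneda.obj (Opposite.op M)).mapHomologicalComplex
                (ComplexShape.up ℕ)).obj (CochainComplex.of Y d w)).homology i) ≃+
            Abelian.Ext M N i) := by

  obtain ⟨-, -, hXZ, hZY⟩ := h
  have hZ : ∀ j, Y j ∈ Zs := by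
    rintro (_ | _ | j)
    · refine mem_of_shortExact hXZ.1 (S := ShortComplex.mk f (cokernel.π f) (by simp)) ?_ hN hcosyz0
      exact
        { exact := ShortComplex.exact_of_g_is_cokernel _ (cokernelIsCokernel _)
          mono_f := hf
          epi_g := inferInstanceAs (Epi (cokernel.π _)) }
    · exact mem_of_exact hXZ.1 f (d 0) w0 hex0 hcosyz0 (hcosyz 0)
    · exact mem_of_exact hXZ.1 (d j) (d (j + 1)) (w j) (hex j) (hcosyz j) (hcosyz (j + 1))
  have hinj : ∀ j, Injective (Y j) := fun j => injective_of_mem hXZ hZY.1 (hZ j) (hY j)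
  refine ⟨hinj, fun M i => ?_⟩
  have hd : ∀ j, (CochainComplex.of Y d w).d j (j + 1) = d j := fun j =>
    CochainComplex.of_d ..
  have hw0 : f ≫ (CochainComplex.of Y d w).d 0 1 = 0 := by rw [hd 0]; exact w0
  obtain ⟨R, hR⟩ := exists_injectiveResolution (N := N) (CochainComplex.of Y d w) hinj f hf hw0
    (by
      have := hex0
      convert this using 2
      exact hd 0)
    (fun n => by
      rw [HomologicalComplex.exactAt_iff' _ n (n + 1) (n + 1 + 1) (by simp) (by simp)]
      have key : ∀ (a : Y n ⟶ Y (n + 1)) (b : Y (n + 1) ⟶ Y (n + 1 + 1)) (wab : a ≫ b = 0),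
          a = d n → b = d (n + 1) → (ShortComplex.mk a b wab).Exact := by
        rintro _ _ _ rfl rfl
        exact hex n
      exact key _ _ ((CochainComplex.of Y d w).d_comp_d n (n + 1) (n + 1 + 1)) (hd n) (hd (n + 1)))
  rw [← hR]
  exact homology_addEquiv_ext R i
end
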